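/- Tail optimality of the first-comonotonic-then-counter-monotonic coupling: Let g be a convex distortion function, p∈(0,1), and let μ, ν be compactly supported Borel probability measures on ℝ. Let (X,Y) be a random vector with copula C^±_p, X ∼ μ and Y ∼ ν. Then for every random vector (X',Y') with X' ∼ μ and Y' ∼ ν: (a) E^g[(X+Y)^∨_p] ≥ E^g[(X'+Y')^∨_p], and (b) E^g[(X+Y)^∧_p] ≤ E^g[(X'+Y')^∧_p]. -/

import Mathlib

open MeasureTheory Set ProbabilityTheory

noncomputable section

variable {Ω : Type*} [MeasurableSpace Ω]

/-- An atomless probability measure: every non-null measurable set has a measurable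
subset of strictly smaller positive measure. -/
def AtomlessProb (P : Measure Ω) : Prop :=
  ∀ A : Set Ω, MeasurableSet A → 0 < P A →
    ∃ B ⊆ A, MeasurableSet B ∧ 0 < P B ∧ P B < P A

/-- A distortion function: increasing on `[0,1]` with `h 0 = 0` and `h 1 = 1`. -/
def IsDistortion (h : ℝ → ℝ) : Prop :=
  MonotoneOn h (Icc 0 1) ∧ h 0 = 0 ∧ h 1 = 1

/-- The distorted expectation `E^h[Z]`. -/
def distExp (P : Measure Ω) (h : ℝ → ℝ) (Z : Ω → ℝ) : ℝ :=
  (∫ x in Ioi (0:ℝ), h (P {ω | Z ω > x}).toReal) +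
  (∫ x in Iio (0:ℝ), (h (P {ω | Z ω > x}).toReal - 1))

/-- Bounded measurable real random variable. -/
def IsBddRV (X : Ω → ℝ) : Prop :=
  Measurable X ∧ ∃ M : ℝ, ∀ ω, |X ω| ≤ M

/-- X and Y are comonotonic. -/
def Comonotone (P : Measure Ω) (X Y : Ω → ℝ) : Prop :=
  ∃ f g : ℝ → ℝ, Monotone f ∧ Monotone g ∧
    ∀ᵐ ω ∂P, X ω = f (X ω + Y ω) ∧ Y ω = g (X ω + Y ω)

/-- X and Y are counter-monotonic: X and -Y are comonotonic. -/
def CounterMonotone (P : Measure Ω) (X Y : Ω → ℝ) : Prop :=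
  Comonotone P X (fun ω => -Y ω)

def Submodular (c : ℝ → ℝ → ℝ) : Prop :=
  ∀ x₁ y₁ x₂ y₂ : ℝ,
    c (min x₁ x₂) (min y₁ y₂) + c (max x₁ x₂) (max y₁ y₂) ≤ c x₁ y₁ + c x₂ y₂

def Supermodular (c : ℝ → ℝ → ℝ) : Prop :=
  ∀ x₁ y₁ x₂ y₂ : ℝ,
    c x₁ y₁ + c x₂ y₂ ≤ c (min x₁ x₂) (min y₁ y₂) + c (max x₁ x₂) (max y₁ y₂)

/-- c is monotone: increasing in each argument or decreasing in each argument. -/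
def MonotoneCost (c : ℝ → ℝ → ℝ) : Prop :=
  Monotone (fun q : ℝ × ℝ => c q.1 q.2) ∨ Antitone (fun q : ℝ × ℝ => c q.1 q.2)

/-- A 2-copula. -/
def IsCopula (C : ℝ → ℝ → ℝ) : Prop :=
  (∀ u ∈ Icc (0:ℝ) 1, C u 0 = 0 ∧ C 0 u = 0 ∧ C u 1 = u ∧ C 1 u = u) ∧
  (∀ u₁ u₂ v₁ v₂ : ℝ, u₁ ∈ Icc (0:ℝ) 1 → u₂ ∈ Icc (0:ℝ) 1 →
    v₁ ∈ Icc (0:ℝ) 1 → v₂ ∈ Icc (0:ℝ) 1 → u₁ ≤ u₂ → v₁ ≤ v₂ →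
    0 ≤ C u₂ v₂ - C u₂ v₁ - C u₁ v₂ + C u₁ v₁)

/-- (X, Y) has copula C. -/
def HasCopula (P : Measure Ω) (X Y : Ω → ℝ) (C : ℝ → ℝ → ℝ) : Prop :=
  ∀ x y : ℝ, (P {ω | X ω ≤ x ∧ Y ω ≤ y}).toReal =
    C (P {ω | X ω ≤ x}).toReal (P {ω | Y ω ≤ y}).toReal

/-- C is universally optimal for h with linear cost. -/
def UnivOptimal (P : Measure Ω) (h : ℝ → ℝ) (C : ℝ → ℝ → ℝ) : Prop :=
  ∀ X Y X' Y' : Ω → ℝ, IsBddRV X → IsBddRV Y → IsBddRV X' → IsBddRV Y' →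
    HasCopula P X Y C → IdentDistrib X X' P P → IdentDistrib Y Y' P P →
    distExp P h (fun ω => X ω + Y ω) ≤ distExp P h (fun ω => X' ω + Y' ω)

/-- C is universally maximal for h with linear cost. -/
def UnivMaximal (P : Measure Ω) (h : ℝ → ℝ) (C : ℝ → ℝ → ℝ) : Prop :=
  ∀ X Y X' Y' : Ω → ℝ, IsBddRV X → IsBddRV Y → IsBddRV X' → IsBddRV Y' →
    HasCopula P X Y C → IdentDistrib X X' P P → IdentDistrib Y Y' P P →
    distExp P h (fun ω => X' ω + Y' ω) ≤ distExp P h (fun ω => X ω + Y ω)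

/-- C is universally optimal within a class 𝒞 of copulas for h with linear cost. -/
def UnivOptimalWithin (P : Measure Ω) (h : ℝ → ℝ) (C : ℝ → ℝ → ℝ)
    (𝒞 : Set (ℝ → ℝ → ℝ)) : Prop :=
  ∀ X Y X' Y' : Ω → ℝ, IsBddRV X → IsBddRV Y → IsBddRV X' → IsBddRV Y' →
    HasCopula P X Y C → (∃ C' ∈ 𝒞, HasCopula P X' Y' C') →
    IdentDistrib X X' P P → IdentDistrib Y Y' P P →
    distExp P h (fun ω => X ω + Y ω) ≤ distExp P h (fun ω => X' ω + Y' ω)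

/-- C is universally maximal within a class 𝒞 of copulas for h with linear cost. -/
def UnivMaximalWithin (P : Measure Ω) (h : ℝ → ℝ) (C : ℝ → ℝ → ℝ)
    (𝒞 : Set (ℝ → ℝ → ℝ)) : Prop :=
  ∀ X Y X' Y' : Ω → ℝ, IsBddRV X → IsBddRV Y → IsBddRV X' → IsBddRV Y' →
    HasCopula P X Y C → (∃ C' ∈ 𝒞, HasCopula P X' Y' C') →
    IdentDistrib X X' P P → IdentDistrib Y Y' P P →
    distExp P h (fun ω => X' ω + Y' ω) ≤ distExp P h (fun ω => X ω + Y ω)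

/-- The set 𝒞_p of copulas C with C(1-p,1-p) = 1-p. -/
def copulaSet (p : ℝ) : Set (ℝ → ℝ → ℝ) :=
  {C | IsCopula C ∧ C (1 - p) (1 - p) = 1 - p}

/-- The "first comonotonic, then counter-monotonic" copula C^±_p. -/
def Cpm (p : ℝ) (u v : ℝ) : ℝ :=
  if min u v ≤ 1 - p then min u v else max (u + v - 1) (1 - p)

/-- The "first counter-monotonic, then comonotonic" copula C^∓_p. -/
def Cmp (p : ℝ) (u v : ℝ) : ℝ :=
  if max u v ≤ 1 - p then max (u + v - 1 + p) 0 else min u v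

/-- Inverse S-shaped distortion with inflection point p: continuous, concave on (0,p),
convex on (p,1). -/
def IsISS (h : ℝ → ℝ) (p : ℝ) : Prop :=
  ContinuousOn h (Icc 0 1) ∧ ConcaveOn ℝ (Ioo 0 p) h ∧ ConvexOn ℝ (Ioo p 1) h

/-- Strictly inverse S-shaped distortion with inflection point p. -/
def IsStrictISS (h : ℝ → ℝ) (p : ℝ) : Prop :=
  ContinuousOn h (Icc 0 1) ∧ StrictConcaveOn ℝ (Ioo 0 p) h ∧ StrictConvexOn ℝ (Ioo p 1) h

/-- S-shaped distortion with inflection point p: continuous, convex on (0,p),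
concave on (p,1). -/
def IsSS (h : ℝ → ℝ) (p : ℝ) : Prop :=
  ContinuousOn h (Icc 0 1) ∧ ConvexOn ℝ (Ioo 0 p) h ∧ ConcaveOn ℝ (Ioo p 1) h

/-- Strictly S-shaped distortion with inflection point p. -/
def IsStrictSS (h : ℝ → ℝ) (p : ℝ) : Prop :=
  ContinuousOn h (Icc 0 1) ∧ StrictConvexOn ℝ (Ioo 0 p) h ∧ StrictConcaveOn ℝ (Ioo p 1) h

/-- Left quantile of Z at level t. -/
def leftQuantile (P : Measure Ω) (Z : Ω → ℝ) (t : ℝ) : ℝ :=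
  sInf {x : ℝ | t ≤ (P {ω | Z ω ≤ x}).toReal}

/-- W is (a version of) the upper p-tail transform Z^∨_p of Z: its left-quantile
function is t ↦ Q_{(1-p)+pt}(Z). -/
def IsUpperTail (P : Measure Ω) (p : ℝ) (Z W : Ω → ℝ) : Prop :=
  ∀ t ∈ Ioc (0:ℝ) 1, leftQuantile P W t = leftQuantile P Z ((1 - p) + p * t)

/-- W is (a version of) the lower tail transform Z^∧_p of Z: its left-quantile
function is t ↦ Q_{(1-p)t}(Z). -/
def IsLowerTail (P : Measure Ω) (p : ℝ) (Z W : Ω → ℝ) : Prop :=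
  ∀ t ∈ Ioc (0:ℝ) 1, leftQuantile P W t = leftQuantile P Z ((1 - p) * t)

/-- Expected Shortfall at level p. -/
def ES (P : Measure Ω) (p : ℝ) (Z : Ω → ℝ) : ℝ :=
  (1 / (1 - p)) * ∫ r in p..1, leftQuantile P Z r

/-- On a bounded interval, a set that is downward closed has an integral that is a limit of
integrals over initial segments, hence inherits nonnegativity from them. -/
lemma setIntegral_inter_lowerSet_nonneg {l r : ℝ} (hlr : l ≤ r) {D : ℝ → ℝ}
    (h : ∀ k ∈ Icc l r, 0 ≤ ∫ x in Ioc l k, D x) {s : Set ℝ} (hs : IsLowerSet s) :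
    0 ≤ ∫ x in Ioc l r ∩ s, D x := by
  set T : Set ℝ := insert l (Ioc l r ∩ s) with hT
  have hbdd : BddAbove T := ⟨r, by
    rintro x (rfl | hx)
    · exact hlr
    · exact hx.1.2⟩
  have hne : T.Nonempty := ⟨l, mem_insert _ _⟩
  have hk : sSup T ∈ Icc l r := ⟨le_csSup hbdd (mem_insert _ _), csSup_le hne (by
    rintro x (rfl | hx)
    · exact hlr
    · exact hx.1.2)⟩
  have hae : (Ioc l r ∩ s : Set ℝ) =ᵐ[volume] Ioc l (sSup T) := by
    have hnull : ∀ᵐ x : ℝ, x ≠ sSup T := by simp [ae_iff]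
    filter_upwards [hnull] with x hx
    refine propext ⟨fun hxs => ⟨hxs.1.1, le_csSup hbdd (mem_insert_of_mem _ hxs)⟩, fun hxk => ?_⟩
    obtain ⟨y, hy, hxy⟩ := exists_lt_of_lt_csSup hne (lt_of_le_of_ne hxk.2 hx)
    rcases hy with rfl | hy
    · exact absurd hxk.1 hxy.not_gt
    · exact ⟨⟨hxk.1, hxy.le.trans hy.1.2⟩, hs hxy.le hy.2⟩
  rw [setIntegral_congr_set hae]
  exact h _ hk

lemma setIntegral_antitone_mul_nonneg {l r m : ℝ} (hlr : l ≤ r) {φ D : ℝ → ℝ}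
    (hφ : Antitone φ) (hφm : ∀ x, φ x ∈ Icc 0 m)
    (hD : Integrable D (volume.restrict (Ioc l r)))
    (h : ∀ k ∈ Icc l r, 0 ≤ ∫ x in Ioc l k, D x) :
    0 ≤ ∫ x in Ioc l r, φ x * D x := by
  set S : Set (ℝ × ℝ) := {q | q.2 < φ q.1} with hS
  have hSm : MeasurableSet S := measurableSet_lt measurable_snd (hφ.measurable.comp measurable_fst)
  have hrep : ∀ x, φ x * D x
      = ∫ t in Ioc 0 m, S.indicator (fun q => D q.1) (x, t) := by
    intro x
    have h1 : (fun t => S.indicator (fun q => D q.1) (x, t))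
        = (Iio (φ x)).indicator (fun _ => D x) := by
      ext t
      simp only [indicator, hS, mem_ofPred_eq, mem_Iio]
    have h2 : Ioc 0 m ∩ Iio (φ x) = Ioo 0 (φ x) := by
      ext t
      simp only [mem_inter_iff, mem_Ioc, mem_Iio, mem_Ioo]
      exact ⟨fun ht => ⟨ht.1.1, ht.2⟩, fun ht => ⟨⟨ht.1, ht.2.le.trans (hφm x).2⟩, ht.2⟩⟩
    rw [h1, setIntegral_indicator measurableSet_Iio, h2]
    simp [(hφm x).1]
  have hint : Integrable (Function.uncurry fun x t => S.indicator (fun q => D q.1) (x, t))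
      ((volume.restrict (Ioc l r)).prod (volume.restrict (Ioc 0 m))) :=
    (hD.comp_fst (volume.restrict (Ioc 0 m))).indicator hSm
  simp_rw [hrep]
  rw [integral_integral_swap hint]
  refine integral_nonneg fun t => ?_
  have h1 : (fun x => S.indicator (fun q => D q.1) (x, t)) = {x | t < φ x}.indicator D := by
    ext x
    simp only [indicator, hS, mem_ofPred_eq]
  have hm : MeasurableSet {x | t < φ x} := measurableSet_lt measurable_const hφ.measurable
  rw [h1, setIntegral_indicator hm]
  exact setIntegral_inter_lowerSet_nonneg hlr h fun x y hyx hx => lt_of_lt_of_le hx (hφ hyx)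

lemma ConvexOn.exists_subgradient_of_slope_bound {h : ℝ → ℝ} {m : ℝ}
    (hc : ConvexOn ℝ (Icc 0 1) h) (hmono : MonotoneOn h (Icc 0 1))
    (hm : ∀ a ∈ Icc (0 : ℝ) 1, m * (a - 1) ≤ h a - h 1) {b : ℝ} (hb : b ∈ Icc (0 : ℝ) 1) :
    ∃ c ∈ Icc 0 m, ∀ a ∈ Icc (0 : ℝ) 1, c * (a - b) ≤ h a - h b := by
  have hm0 : 0 ≤ m := by
    have h0 := hm 0 (by simp)
    have h1 := hmono (show (0 : ℝ) ∈ Icc 0 1 by simp) (show (1 : ℝ) ∈ Icc 0 1 by simp) zero_le_one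
    linarith
  rcases hb.1.eq_or_lt with rfl | hb0
  · exact ⟨0, ⟨le_rfl, hm0⟩, fun a ha => by linarith [hmono hb ha ha.1]⟩
  rcases hb.2.eq_or_lt with rfl | hb1
  · exact ⟨m, ⟨hm0, le_rfl⟩, hm⟩
  have hbi : b ∈ interior (Icc (0 : ℝ) 1) := by simp [hb0, hb1]
  set c := derivWithin h (Ioi b) b with hcdef
  have hright : ∀ a ∈ Icc (0 : ℝ) 1, b < a → c * (a - b) ≤ h a - h b := fun a ha hba => by
    have := hc.rightDeriv_le_slope_of_mem_interior hbi ha hba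
    rw [slope_def_field, le_div_iff₀ (by linarith)] at this
    exact this
  have hleft : ∀ a ∈ Icc (0 : ℝ) 1, a < b → c * (a - b) ≤ h a - h b := fun a ha hab => by
    have := (hc.slope_le_leftDeriv_of_mem_interior ha hbi hab).trans
      (hc.leftDeriv_le_rightDeriv_of_mem_interior hbi)
    rw [slope_def_field, div_le_iff₀ (by linarith)] at this
    linarith
  have hall : ∀ a ∈ Icc (0 : ℝ) 1, c * (a - b) ≤ h a - h b := fun a ha => by
    rcases lt_trichotomy a b with hab | rfl | hab
    · exact hleft a ha hab
    · simp
    · exact hright a ha hab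
  refine ⟨c, ⟨?_, ?_⟩, hall⟩
  · have h0 := hall 0 (by simp)
    have h1 := hmono (show (0 : ℝ) ∈ Icc 0 1 by simp) hb hb.1
    nlinarith
  · have h0 := hall 1 (by simp)
    have h1 := hm b hb
    have : c * (1 - b) ≤ m * (1 - b) := by linarith
    exact le_of_mul_le_mul_right this (by linarith)

lemma integrableOn_comp_of_antitone {h A : ℝ → ℝ} (hmono : MonotoneOn h (Icc 0 1))
    (hA : Antitone A) (hA01 : ∀ x, A x ∈ Icc (0 : ℝ) 1) {l r : ℝ} :
    IntegrableOn (fun x => h (A x)) (Ioc l r) := by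
  have : Antitone fun x => h (A x) := fun x y hxy => hmono (hA01 y) (hA01 x) (hA hxy)
  exact (this.antitoneOn _).integrableOn_isCompact isCompact_Icc |>.mono_set Ioc_subset_Icc_self

lemma setIntegral_convex_comp_le_of_slope_bound {h A B : ℝ → ℝ} {m l r : ℝ} (hlr : l ≤ r)
    (hc : ConvexOn ℝ (Icc 0 1) h) (hmono : MonotoneOn h (Icc 0 1))
    (hm : ∀ a ∈ Icc (0 : ℝ) 1, m * (a - 1) ≤ h a - h 1)
    (hA : Antitone A) (hB : Antitone B)
    (hA01 : ∀ x, A x ∈ Icc (0 : ℝ) 1) (hB01 : ∀ x, B x ∈ Icc (0 : ℝ) 1)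
    (hAB : ∀ k ∈ Icc l r, ∫ x in Ioc l k, B x ≤ ∫ x in Ioc l k, A x) :
    ∫ x in Ioc l r, h (B x) ≤ ∫ x in Ioc l r, h (A x) := by
  choose! c hcm hcs using fun b => hc.exists_subgradient_of_slope_bound hmono hm (b := b)
  have hcmono : MonotoneOn c (Icc 0 1) := by
    intro b₁ h₁ b₂ h₂ h12
    rcases h12.eq_or_lt with rfl | hlt
    · exact le_rfl
    have e₁ := hcs b₁ h₁ b₂ h₂
    have e₂ := hcs b₂ h₂ b₁ h₁
    have : c b₁ * (b₂ - b₁) ≤ c b₂ * (b₂ - b₁) := by linarith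
    exact le_of_mul_le_mul_right this (by linarith)
  have hφ : Antitone fun x => c (B x) := fun x y hxy => hcmono (hB01 y) (hB01 x) (hB hxy)
  have hid : MonotoneOn (fun x : ℝ => x) (Icc 0 1) := fun _ _ _ _ h => h
  have iA : ∀ k, IntegrableOn A (Ioc l k) := fun k => integrableOn_comp_of_antitone hid hA hA01
  have iB : ∀ k, IntegrableOn B (Ioc l k) := fun k => integrableOn_comp_of_antitone hid hB hB01
  have ihA := integrableOn_comp_of_antitone hmono hA hA01 (l := l) (r := r)
  have ihB := integrableOn_comp_of_antitone hmono hB hB01 (l := l) (r := r)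
  have hD : Integrable (fun x => A x - B x) (volume.restrict (Ioc l r)) := (iA r).sub (iB r)
  have key := setIntegral_antitone_mul_nonneg hlr hφ (fun x => hcm _ (hB01 x)) hD fun k hk => by
    rw [integral_sub (iA k) (iB k)]
    linarith [hAB k hk]
  have hφD : Integrable (fun x => c (B x) * (A x - B x)) (volume.restrict (Ioc l r)) :=
    hD.bdd_mul hφ.measurable.aestronglyMeasurable (c := m) (.of_forall fun x => by
      rw [Real.norm_eq_abs, abs_of_nonneg (hcm _ (hB01 x)).1]
      exact (hcm _ (hB01 x)).2)
  have : ∫ x in Ioc l r, c (B x) * (A x - B x) ≤ ∫ x in Ioc l r, (h (A x) - h (B x)) :=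
    integral_mono hφD (ihA.sub ihB) fun x => hcs _ (hB01 x) _ (hA01 x)
  rw [integral_sub ihA ihB] at this
  linarith

/-- Second-order stochastic dominance of survival functions is preserved by convex distortions. -/
lemma setIntegral_convex_comp_le {g A B : ℝ → ℝ} {l r : ℝ} (hlr : l ≤ r)
    (hg : IsDistortion g) (hc : ConvexOn ℝ (Icc 0 1) g)
    (hA : Antitone A) (hB : Antitone B)
    (hA01 : ∀ x, A x ∈ Icc (0 : ℝ) 1) (hB01 : ∀ x, B x ∈ Icc (0 : ℝ) 1)
    (hAB : ∀ k ∈ Icc l r, ∫ x in Ioc l k, B x ≤ ∫ x in Ioc l k, A x) :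
    ∫ x in Ioc l r, g (B x) ≤ ∫ x in Ioc l r, g (A x) := by
  obtain ⟨hmono, hg0, hg1⟩ := hg
  have hmem0 : (0 : ℝ) ∈ Icc (0 : ℝ) 1 := by simp
  have hmem1 : (1 : ℝ) ∈ Icc (0 : ℝ) 1 := by simp
  set m : ℕ → ℝ := fun n => (1 - g (1 - 1 / ((n : ℝ) + 1))) * ((n : ℝ) + 1) with hmdef
  have hn : ∀ n : ℕ, (0 : ℝ) < (n : ℝ) + 1 := fun n => by positivity
  have hpt : ∀ n : ℕ, 1 - 1 / ((n : ℝ) + 1) ∈ Icc (0 : ℝ) 1 := fun n => by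
    have : 1 / ((n : ℝ) + 1) ≤ 1 := by
      rw [div_le_one (hn n)]; linarith [Nat.cast_nonneg (α := ℝ) n]
    have := one_div_pos.2 (hn n)
    constructor <;> linarith
  have hm0 : ∀ n, 0 ≤ m n := fun n =>
    mul_nonneg (by linarith [hmono (hpt n) hmem1 (hpt n).2]) (hn n).le
  set f : ℕ → ℝ → ℝ := fun n s => max (g s) (1 + m n * (s - 1)) with hf
  have hf1 : ∀ n, f n 1 = 1 := fun n => by simp [hf, hg1]
  have hfc : ∀ n, ConvexOn ℝ (Icc 0 1) (f n) := fun n => by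
    refine hc.sup ⟨convex_Icc _ _, fun x _ y _ a b _ _ hab => le_of_eq ?_⟩
    simp only [smul_eq_mul]
    linear_combination (-1 + m n) * hab
  have hfm : ∀ n, MonotoneOn (f n) (Icc 0 1) := fun n x hx y hy hxy =>
    max_le_max (hmono hx hy hxy) (by nlinarith [hm0 n])
  have hstep : ∀ n, ∫ x in Ioc l r, g (B x) ≤ ∫ x in Ioc l r, f n (A x) := fun n =>
    (integral_mono (integrableOn_comp_of_antitone hmono hB hB01)
      (integrableOn_comp_of_antitone (hfm n) hB hB01) fun x => le_max_left _ _).trans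
    (setIntegral_convex_comp_le_of_slope_bound hlr (hfc n) (hfm n) (m := m n)
      (fun a _ => by
        rw [hf1]
        linarith [le_max_right (g a) (1 + m n * (a - 1))]) hA hB hA01 hB01 hAB)
  have hlim : ∀ s ∈ Icc (0 : ℝ) 1, ∀ᶠ n : ℕ in Filter.atTop, f n s = g s := by
    intro s hs
    rcases hs.2.eq_or_lt with rfl | hs1
    · exact .of_forall fun n => by rw [hf1, hg1]
    obtain ⟨N, hN⟩ := exists_nat_one_div_lt (show 0 < 1 - s by linarith)
    filter_upwards [Filter.eventually_ge_atTop N] with n hNn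
    refine max_eq_left ?_
    have hd : 1 / ((n : ℝ) + 1) < 1 - s :=
      (one_div_le_one_div_of_le (hn N) (by exact_mod_cast Nat.succ_le_succ hNn)).trans_lt hN
    have hd0 := one_div_pos.2 (hn n)
    have := hc.slope_mono_adjacent (x := s) (y := 1 - 1 / ((n : ℝ) + 1)) (z := 1) hs hmem1
      (by linarith) (by linarith)
    have he : (g 1 - g (1 - 1 / ((n : ℝ) + 1))) / (1 - (1 - 1 / ((n : ℝ) + 1))) = m n := by
      rw [hg1, hmdef]; field_simp; ring
    rw [he, div_le_iff₀ (by linarith)] at this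
    have hmn : m n * (1 / ((n : ℝ) + 1)) = 1 - g (1 - 1 / ((n : ℝ) + 1)) := by
      rw [hmdef]; field_simp
    nlinarith
  refine ge_of_tendsto' (f := fun n => ∫ x in Ioc l r, f n (A x)) (x := Filter.atTop) ?_ hstep
  refine tendsto_integral_of_dominated_convergence (fun _ => 1) (fun n =>
    (integrableOn_comp_of_antitone (hfm n) hA hA01).aestronglyMeasurable)
    (integrable_const _) (fun n => .of_forall fun x => ?_) (.of_forall fun x => ?_)
  · rw [Real.norm_eq_abs, abs_le]
    have h0 := (hmono hmem0 (hA01 x) (hA01 x).1).trans (le_max_left _ (1 + m n * (A x - 1)))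
    have h1 := hfm n (hA01 x) hmem1 (hA01 x).2
    rw [hf1] at h1
    exact ⟨by simp only [hf]; linarith, h1⟩
  · exact tendsto_const_nhds.congr' ((hlim _ (hA01 x)).mono fun n hn => hn.symm)

lemma antitone_survival (P : Measure Ω) [IsFiniteMeasure P] (Z : Ω → ℝ) :
    Antitone fun x => (P {ω | Z ω > x}).toReal := fun x y hxy =>
  measureReal_mono (μ := P) fun ω (hω : y < Z ω) => lt_of_le_of_lt hxy hω

lemma survival_mem_Icc (P : Measure Ω) [IsProbabilityMeasure P] (Z : Ω → ℝ) (x : ℝ) :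
    (P {ω | Z ω > x}).toReal ∈ Icc (0 : ℝ) 1 :=
  ⟨ENNReal.toReal_nonneg, measureReal_le_one (μ := P)⟩

lemma distExp_eq_setIntegral_sub {P : Measure Ω} [IsProbabilityMeasure P] {h : ℝ → ℝ}
    (hh : IsDistortion h) {Z : Ω → ℝ} {M : ℝ} (hM : 0 ≤ M) (hZ : ∀ ω, |Z ω| ≤ M) :
    distExp P h Z = (∫ x in Ioc (-M) M, h (P {ω | Z ω > x}).toReal) - M := by
  obtain ⟨hmono, h0, h1⟩ := hh
  set f : ℝ → ℝ := fun x => h (P {ω | Z ω > x}).toReal with hf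
  have hi : ∀ l r, IntegrableOn f (Ioc l r) := fun l r =>
    integrableOn_comp_of_antitone hmono (antitone_survival P Z) (survival_mem_Icc P Z)
  have hpos : ∫ x in Ioi (0 : ℝ), f x = ∫ x in Ioc 0 M, f x := by
    refine setIntegral_eq_of_subset_of_forall_sdiff_eq_zero measurableSet_Ioi
      Ioc_subset_Ioi_self fun x hx => ?_
    have hMx : M < x := by
      by_contra! hle
      exact hx.2 ⟨hx.1, hle⟩
    have : {ω | Z ω > x} = ∅ := eq_empty_of_forall_notMem fun ω (hω : x < Z ω) => by
      linarith [le_abs_self (Z ω), hZ ω]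
    simp [hf, this, h0]
  have hneg : ∫ x in Iio (0 : ℝ), (f x - 1) = ∫ x in Ioc (-M) 0, (f x - 1) := by
    rw [← integral_Ico_eq_integral_Ioc]
    refine setIntegral_eq_of_subset_of_forall_sdiff_eq_zero measurableSet_Iio
      Ico_subset_Iio_self fun x hx => ?_
    have hMx : x < -M := by
      by_contra! hle
      exact hx.2 ⟨hle, hx.1⟩
    have : {ω | Z ω > x} = univ := eq_univ_of_forall fun ω => by
      change x < Z ω
      linarith [neg_abs_le (Z ω), hZ ω]
    simp [hf, this, h1]
  have hunion : ∫ x in Ioc (-M) M, f x = (∫ x in Ioc (-M) 0, f x) + ∫ x in Ioc 0 M, f x := by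
    rw [← Ioc_union_Ioc_eq_Ioc (neg_nonpos.2 hM) hM]
    exact setIntegral_union (Ioc_disjoint_Ioc_of_le le_rfl) measurableSet_Ioc (hi _ _) (hi _ _)
  have hsub : ∫ x in Ioc (-M) 0, (f x - 1) = (∫ x in Ioc (-M) 0, f x) - M := by
    rw [integral_sub (hi _ _) (integrable_const _)]
    simp [hM]
  change (∫ x in Ioi (0 : ℝ), f x) + (∫ x in Iio (0 : ℝ), (f x - 1)) = _
  rw [hpos, hneg, hsub, hunion]
  ring

lemma setIntegral_survival_eq {P : Measure Ω} [IsProbabilityMeasure P] {Z : Ω → ℝ}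
    (hZm : Measurable Z) {M k : ℝ} (hk : -M ≤ k) (hZ : ∀ ω, |Z ω| < M) :
    ∫ x in Ioc (-M) k, (P {ω | Z ω > x}).toReal
      = (k + M) - (∫⁻ x in Iic k, P {ω | Z ω ≤ x}).toReal := by
  have hmono : Monotone fun x => P {ω | Z ω ≤ x} := fun x y hxy =>
    measure_mono fun ω (hω : Z ω ≤ x) => hω.trans hxy
  have hcompl : ∀ x, (P {ω | Z ω > x}).toReal = 1 - (P {ω | Z ω ≤ x}).toReal := fun x => by
    have : {ω | Z ω > x} = {ω | Z ω ≤ x}ᶜ := by ext; simp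
    rw [this]
    exact probReal_compl_eq_one_sub (μ := P) (measurableSet_le hZm measurable_const)
  have hsplit : ∫⁻ x in Iic k, P {ω | Z ω ≤ x} = ∫⁻ x in Ioc (-M) k, P {ω | Z ω ≤ x} := by
    rw [← Iic_union_Ioc_eq_Iic hk, lintegral_union measurableSet_Ioc
      (Iic_disjoint_Ioc le_rfl), setLIntegral_congr_fun (g := fun _ => 0) measurableSet_Iic]
    · simp
    · intro x (hx : x ≤ -M)
      have : {ω | Z ω ≤ x} = ∅ := eq_empty_of_forall_notMem fun ω (hω : Z ω ≤ x) => by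
        linarith [neg_abs_le (Z ω), hZ ω]
      simp [this]
  have hi : IntegrableOn (fun x => (P {ω | Z ω ≤ x}).toReal) (Ioc (-M) k) :=
    ((Monotone.monotoneOn (fun x y hxy => ENNReal.toReal_mono (measure_ne_top _ _)
      (hmono hxy)) _).integrableOn_isCompact isCompact_Icc).mono_set Ioc_subset_Icc_self
  simp_rw [hcompl]
  rw [integral_sub (integrable_const _) hi, hsplit,
    integral_toReal hmono.measurable.aemeasurable (.of_forall fun x => measure_lt_top _ _)]
  have : 0 ≤ k + M := by linarith
  simp [this]

/-- Monotonicity of distorted expectations with convex distortion in the increasing concave order. -/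
lemma distExp_le_of_lintegral_cdf_le {P : Measure Ω} [IsProbabilityMeasure P] {g : ℝ → ℝ}
    (hg : IsDistortion g) (hc : ConvexOn ℝ (Icc 0 1) g) {W W' : Ω → ℝ}
    (hW : IsBddRV W) (hW' : IsBddRV W')
    (h : ∀ k, ∫⁻ x in Iic k, P {ω | W ω ≤ x} ≤ ∫⁻ x in Iic k, P {ω | W' ω ≤ x}) :
    distExp P g W' ≤ distExp P g W := by
  obtain ⟨hWm, M₁, hM₁⟩ := hW
  obtain ⟨hWm', M₂, hM₂⟩ := hW'
  set M := max (max M₁ M₂) 0 + 1 with hM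
  have hM0 : 0 ≤ M := by positivity
  have hWM : ∀ ω, |W ω| < M := fun ω => by
    linarith [hM₁ ω, le_max_left M₁ M₂, le_max_left (max M₁ M₂) 0]
  have hWM' : ∀ ω, |W' ω| < M := fun ω => by
    linarith [hM₂ ω, le_max_right M₁ M₂, le_max_left (max M₁ M₂) 0]
  rw [distExp_eq_setIntegral_sub hg hM0 fun ω => (hWM ω).le,
    distExp_eq_setIntegral_sub hg hM0 fun ω => (hWM' ω).le]
  refine sub_le_sub_right (setIntegral_convex_comp_le (by linarith) hg hc (antitone_survival P W)
    (antitone_survival P W') (survival_mem_Icc P W) (survival_mem_Icc P W') fun k hk => ?_) _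
  rw [setIntegral_survival_eq hWm hk.1 hWM, setIntegral_survival_eq hWm' hk.1 hWM']
  refine sub_le_sub_left (ENNReal.toReal_mono (ne_of_lt ?_) (h k)) _
  calc ∫⁻ x in Iic k, P {ω | W' ω ≤ x}
      ≤ ∫⁻ x in Iic k, (Ioi (-M)).indicator (fun _ => 1) x := by
        refine lintegral_mono fun x => ?_
        by_cases hx : x ∈ Ioi (-M)
        · simp [hx, prob_le_one]
        · have hxM : x ≤ -M := not_lt.1 hx
          have : {ω | W' ω ≤ x} = ∅ := eq_empty_of_forall_notMem fun ω (hω : W' ω ≤ x) => by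
            linarith [neg_abs_le (W' ω), hWM' ω]
          simp [this]
    _ < ⊤ := by
        rw [lintegral_indicator measurableSet_Ioi]
        simp [Measure.restrict_restrict measurableSet_Ioi, Ioi_inter_Iic]

lemma lintegral_Iic_measure_add_le (τ : Measure Ω) [SFinite τ] {X Y : Ω → ℝ}
    (hX : Measurable X) (hY : Measurable Y) (k : ℝ) :
    ∫⁻ x in Iic k, τ {ω | X ω + Y ω ≤ x} = ∫⁻ s, τ {ω | X ω ≤ s ∧ Y ω ≤ k - s} := by
  have hsum : MeasurableSet {q : Ω × ℝ | X q.1 + Y q.1 ≤ q.2} :=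
    measurableSet_le ((hX.add hY).comp measurable_fst) measurable_snd
  have hrect : MeasurableSet {q : Ω × ℝ | X q.1 ≤ q.2 ∧ Y q.1 ≤ k - q.2} :=
    (measurableSet_le (hX.comp measurable_fst) measurable_snd).inter
      (measurableSet_le (hY.comp measurable_fst) (measurable_const.sub measurable_snd))
  have e₁ := (Measure.prod_apply_symm (μ := τ) (ν := volume.restrict (Iic k)) hsum).symm.trans
    (Measure.prod_apply hsum)
  have e₂ := (Measure.prod_apply_symm (μ := τ) (ν := (volume : Measure ℝ)) hrect).symm.trans
    (Measure.prod_apply hrect)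
  refine (e₁.trans ?_).trans e₂.symm
  refine lintegral_congr fun ω => ?_
  have h₁ : Prod.mk ω ⁻¹' {q : Ω × ℝ | X q.1 + Y q.1 ≤ q.2} = Ici (X ω + Y ω) := by
    ext; simp
  have h₂ : Prod.mk ω ⁻¹' {q : Ω × ℝ | X q.1 ≤ q.2 ∧ Y q.1 ≤ k - q.2} = Icc (X ω) (k - Y ω) := by
    ext x
    simp only [mem_preimage, mem_ofPred_eq, mem_Icc]
    constructor <;> rintro ⟨ha, hb⟩ <;> exact ⟨ha, by linarith⟩
  rw [h₁, h₂, Measure.restrict_apply measurableSet_Ici, Ici_inter_Iic, Real.volume_Icc,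
    Real.volume_Icc]
  congr 1
  ring

lemma exists_measure_between (P : Measure Ω) [IsFiniteMeasure P] {D E : Set Ω}
    (hD : MeasurableSet D) (hE : MeasurableSet E) (hDE : D ⊆ E) {q : ℝ}
    (hDq : P.real D ≤ q) (hqE : q ≤ P.real E) :
    ∃ ρ : Measure Ω, P.restrict D ≤ ρ ∧ ρ ≤ P.restrict E ∧ ρ.real univ = q := by
  obtain ⟨θ, hθ0, hθ1, hθ⟩ : ∃ θ : ℝ, 0 ≤ θ ∧ θ ≤ 1 ∧ P.real D + θ * P.real (E \ D) = q := by
    rw [measureReal_sdiff hDE hD]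
    rcases (hDq.trans hqE).eq_or_lt with h | h
    · exact ⟨0, le_rfl, zero_le_one, by linarith⟩
    · have h' := sub_pos.2 h
      refine ⟨(q - P.real D) / (P.real E - P.real D), div_nonneg (by linarith) h'.le, ?_, ?_⟩
      · rw [div_le_one h']; linarith
      · field_simp; ring
  refine ⟨P.restrict D + ENNReal.ofReal θ • P.restrict (E \ D), Measure.le_add_right le_rfl, ?_, ?_⟩
  · have hsplit : P.restrict E = P.restrict D + P.restrict (E \ D) := by
      rw [← Measure.restrict_union disjoint_sdiff_right (hE.diff hD), union_sdiff_cancel hDE]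
    rw [hsplit]
    gcongr
    intro s
    rw [Measure.smul_apply, smul_eq_mul]
    exact mul_le_of_le_one_left' (ENNReal.ofReal_le_one.2 hθ1)
  · rw [← hθ, measureReal_def, Measure.add_apply, Measure.smul_apply, Measure.restrict_apply_univ,
      Measure.restrict_apply_univ, smul_eq_mul, ENNReal.toReal_add (by finiteness) (by finiteness),
      ENNReal.toReal_mul, ENNReal.toReal_ofReal hθ0]
    rfl

lemma leftQuantile_le_iff {P : Measure Ω} [IsProbabilityMeasure P] {Z : Ω → ℝ} (hZ : Measurable Z)
    {t : ℝ} (ht : t ∈ Ioo (0 : ℝ) 1) (x : ℝ) :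
    leftQuantile P Z t ≤ x ↔ t ≤ P.real {ω | Z ω ≤ x} := by
  have : IsProbabilityMeasure (P.map Z) := Measure.isProbabilityMeasure_map hZ.aemeasurable
  have hcdf : ∀ y, (P {ω | Z ω ≤ y}).toReal = cdf (P.map Z) y := fun y => by
    rw [cdf_eq_real, measureReal_def, Measure.map_apply hZ measurableSet_Iic]
    rfl
  rw [measureReal_def, leftQuantile]
  simp_rw [hcdf]
  set S := {y : ℝ | t ≤ cdf (P.map Z) y} with hS
  have hne : S.Nonempty :=
    ((tendsto_cdf_atTop (P.map Z)).eventually_const_le ht.2).exists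
  have hbdd : BddBelow S := by
    obtain ⟨b, hb⟩ := ((tendsto_cdf_atBot (P.map Z)).eventually_lt_const ht.1).exists
    refine ⟨b, fun y (hy : t ≤ _) => ?_⟩
    by_contra! hlt
    linarith [monotone_cdf (P.map Z) hlt.le]
  refine ⟨fun hx => ?_, fun hx => csInf_le hbdd hx⟩
  have hr : Filter.Tendsto (cdf (P.map Z)) (nhdsWithin x (Ioi x)) (nhds (cdf (P.map Z) x)) :=
    ((cdf (P.map Z)).right_continuous x).tendsto.mono_left (nhdsWithin_mono _ Ioi_subset_Ici_self)
  refine ge_of_tendsto hr ?_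
  filter_upwards [self_mem_nhdsWithin] with y (hy : x < y)
  obtain ⟨z, hz, hzy⟩ := exists_lt_of_csInf_lt hne (hx.trans_lt hy)
  exact le_trans hz (monotone_cdf _ hzy.le)

lemma measureReal_lt_le_of_forall_le {P : Measure Ω} [IsFiniteMeasure P] {Z : Ω → ℝ}
    {a q : ℝ} (h : ∀ s < a, P.real {ω | Z ω ≤ s} ≤ q) : P.real {ω | Z ω < a} ≤ q := by
  have hU : {ω | Z ω < a} = ⋃ n : ℕ, {ω | Z ω ≤ a - 1 / ((n : ℝ) + 1)} := by
    ext ω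
    simp only [mem_ofPred_eq, mem_iUnion]
    constructor
    · intro hω
      obtain ⟨n, hn⟩ := exists_nat_one_div_lt (sub_pos.2 hω)
      exact ⟨n, by linarith⟩
    · rintro ⟨n, hn⟩
      have : 0 < 1 / ((n : ℝ) + 1) := by positivity
      linarith
  have hmono : Monotone fun n : ℕ => {ω | Z ω ≤ a - 1 / ((n : ℝ) + 1)} := by
    intro m n hmn ω (hω : Z ω ≤ _)
    have := Nat.one_div_le_one_div (α := ℝ) hmn
    exact hω.trans (by linarith)
  have ht := (ENNReal.tendsto_toReal (measure_ne_top P _)).comp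
    (tendsto_measure_iUnion_atTop (μ := P) hmono)
  rw [← hU] at ht
  refine le_of_tendsto' ht fun n => h _ ?_
  have : 0 < 1 / ((n : ℝ) + 1) := by positivity
  linarith

/-- The part of `P` carried by the joint lower tail of `(X, Y)`, for pairs that are comonotonic up to
joint level `q`. -/
lemma exists_joint_lower_tail {P : Measure Ω} [IsProbabilityMeasure P] {X Y : Ω → ℝ}
    (hX : Measurable X) (hY : Measurable Y) {q : ℝ} (hq : q ∈ Ioo (0 : ℝ) 1)
    (hH : ∀ s t, min q (min (P.real {ω | X ω ≤ s}) (P.real {ω | Y ω ≤ t}))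
      ≤ P.real {ω | X ω ≤ s ∧ Y ω ≤ t}) :
    ∃ ρ ≤ P, ρ.real univ = q ∧ ∀ s t, min q (P.real {ω | X ω ≤ s ∧ Y ω ≤ t})
      ≤ ρ.real {ω | X ω ≤ s ∧ Y ω ≤ t} := by
  have mX : ∀ s, MeasurableSet {ω | X ω ≤ s} := fun s => measurableSet_le hX measurable_const
  have mY : ∀ t, MeasurableSet {ω | Y ω ≤ t} := fun t => measurableSet_le hY measurable_const
  have mXY : ∀ s t, MeasurableSet {ω | X ω ≤ s ∧ Y ω ≤ t} := fun s t => (mX s).inter (mY t)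
  set a := leftQuantile P X q with ha
  set b := leftQuantile P Y q with hb
  have hFa : q ≤ P.real {ω | X ω ≤ a} := (leftQuantile_le_iff hX hq a).1 le_rfl
  have hGb : q ≤ P.real {ω | Y ω ≤ b} := (leftQuantile_le_iff hY hq b).1 le_rfl
  have hFs : ∀ s < a, P.real {ω | X ω ≤ s} < q := fun s hs => by
    by_contra! h
    exact ((leftQuantile_le_iff hX hq s).2 h).not_gt hs
  have hGt : ∀ t < b, P.real {ω | Y ω ≤ t} < q := fun t ht => by
    by_contra! h
    exact ((leftQuantile_le_iff hY hq t).2 h).not_gt ht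
  set N := {ω | X ω ≤ a ∧ Y ω ≤ b} with hN
  set D := {ω | X ω ≤ a ∧ Y ω ≤ b ∧ (X ω < a ∨ Y ω < b)} with hD
  have hDm : MeasurableSet D := (mX a).inter ((mY b).inter
    ((measurableSet_lt hX measurable_const).union (measurableSet_lt hY measurable_const)))
  have hDN : D ⊆ N := fun ω hω => ⟨hω.1, hω.2.1⟩
  have hNq : q ≤ P.real N := (le_min le_rfl (le_min hFa hGb)).trans (hH a b)
  have hDq : P.real D ≤ q := by
    have hsub : D ⊆ {ω | min (X ω - a) (Y ω - b) < 0} := fun ω hω => by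
      simpa [sub_neg] using hω.2.2
    refine (measureReal_mono hsub).trans (measureReal_lt_le_of_forall_le fun s hs => ?_)
    have hU : {ω | min (X ω - a) (Y ω - b) ≤ s} = {ω | X ω ≤ a + s} ∪ {ω | Y ω ≤ b + s} := by
      ext ω
      simp only [mem_ofPred_eq, mem_union, min_le_iff, sub_le_iff_le_add']
    have hI : {ω | X ω ≤ a + s} ∩ {ω | Y ω ≤ b + s} = {ω | X ω ≤ a + s ∧ Y ω ≤ b + s} := rfl
    have hui := measureReal_union_add_inter (μ := P) (s := {ω | X ω ≤ a + s}) (mY (b + s))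
    rw [hI] at hui
    rw [hU]
    have h₁ := hFs (a + s) (by linarith)
    have h₂ := hGt (b + s) (by linarith)
    have h₃ := hH (a + s) (b + s)
    rw [min_eq_right (min_le_of_left_le h₁.le)] at h₃
    rcases min_choice (P.real {ω | X ω ≤ a + s}) (P.real {ω | Y ω ≤ b + s}) with h | h <;>
      rw [h] at h₃ <;> linarith
  obtain ⟨ρ, hDρ, hρN, hρq⟩ := exists_measure_between P hDm (mXY a b) hDN hDq hNq
  have hρP : ρ ≤ P := hρN.trans Measure.restrict_le_self
  have hρfin : IsFiniteMeasure ρ := isFiniteMeasure_of_le P hρP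
  have hsmall : ∀ B, MeasurableSet B → P.real (B \ D) = 0 → P.real B ≤ ρ.real B := fun B hB h0 => by
    have h₁ : (P.restrict D).real B ≤ ρ.real B :=
      ENNReal.toReal_mono (measure_ne_top _ _) (hDρ B)
    rw [measureReal_restrict_apply hB] at h₁
    linarith [measureReal_inter_add_sdiff (μ := P) (s := B) hDm]
  refine ⟨ρ, hρP, hρq, fun s t => ?_⟩
  rcases lt_or_ge s a with hs | hs
  · refine (min_le_right _ _).trans (hsmall _ (mXY s t) (le_antisymm ?_ measureReal_nonneg))
    have hsub : {ω | X ω ≤ s ∧ Y ω ≤ t} \ D ⊆ {ω | X ω ≤ s} \ {ω | Y ω ≤ b} := fun ω hω =>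
      ⟨hω.1.1, fun hY => hω.2 ⟨hω.1.1.trans hs.le, hY, Or.inl (lt_of_le_of_lt hω.1.1 hs)⟩⟩
    refine (measureReal_mono hsub).trans ?_
    have h₁ := measureReal_inter_add_sdiff (μ := P) (s := {ω | X ω ≤ s}) (mY b)
    have h₂ := hH s b
    rw [min_eq_right (min_le_of_left_le (hFs s hs).le), min_eq_left ((hFs s hs).le.trans hGb)] at h₂
    change P.real {ω | X ω ≤ s ∧ Y ω ≤ b} + _ = _ at h₁
    linarith
  rcases lt_or_ge t b with ht | ht
  · refine (min_le_right _ _).trans (hsmall _ (mXY s t) (le_antisymm ?_ measureReal_nonneg))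
    have hsub : {ω | X ω ≤ s ∧ Y ω ≤ t} \ D ⊆ {ω | Y ω ≤ t} \ {ω | X ω ≤ a} := fun ω hω =>
      ⟨hω.1.2, fun hX => hω.2 ⟨hX, hω.1.2.trans ht.le, Or.inr (lt_of_le_of_lt hω.1.2 ht)⟩⟩
    refine (measureReal_mono hsub).trans ?_
    have h₁ := measureReal_inter_add_sdiff (μ := P) (s := {ω | Y ω ≤ t}) (mX a)
    have h₂ := hH a t
    rw [min_eq_right (min_le_of_right_le (hGt t ht).le), min_eq_right ((hGt t ht).le.trans hFa)] at h₂
    rw [inter_comm] at h₁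
    change P.real {ω | X ω ≤ a ∧ Y ω ≤ t} + _ = _ at h₁
    linarith
  · refine (min_le_left _ _).trans ?_
    have hNc : ρ.real Nᶜ = 0 := by
      have h := ENNReal.toReal_mono (measure_ne_top _ _) (hρN Nᶜ)
      rw [Measure.restrict_apply (mXY a b).compl, compl_inter_self, measure_empty] at h
      exact le_antisymm h measureReal_nonneg
    have h := measureReal_compl (μ := ρ) (mXY a b)
    have hNB : ρ.real N ≤ ρ.real {ω | X ω ≤ s ∧ Y ω ≤ t} :=
      measureReal_mono fun ω hω => ⟨hω.1.trans hs, hω.2.trans ht⟩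
    change ρ.real Nᶜ = _ - ρ.real N at h
    linarith

/-- The part of `P` carried by the lower tail of `Z`. -/
lemma exists_lower_tail {P : Measure Ω} [IsProbabilityMeasure P] {Z : Ω → ℝ}
    (hZ : Measurable Z) {q : ℝ} (hq : q ∈ Ioo (0 : ℝ) 1) :
    ∃ ρ ≤ P, ρ.real univ = q ∧ ∀ x, min q (P.real {ω | Z ω ≤ x}) ≤ ρ.real {ω | Z ω ≤ x} := by
  obtain ⟨ρ, hρP, hρq, hρ⟩ := exists_joint_lower_tail hZ hZ hq fun s t => by
    refine (min_le_right _ _).trans ?_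
    rcases le_total s t with h | h
    · exact (min_le_left _ _).trans
        (measureReal_mono (μ := P) fun ω (hω : Z ω ≤ s) => ⟨hω, hω.trans h⟩)
    · exact (min_le_right _ _).trans
        (measureReal_mono (μ := P) fun ω (hω : Z ω ≤ t) => ⟨hω.trans h, hω⟩)
  exact ⟨ρ, hρP, hρq, fun x => by simpa only [and_self] using hρ x x⟩

lemma measureReal_le_min_of_le {P ρ : Measure Ω} [IsFiniteMeasure P] (h : ρ ≤ P) {q : ℝ}
    (hq : ρ.real univ = q) (B : Set Ω) : ρ.real B ≤ min q (P.real B) := by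
  have : IsFiniteMeasure ρ := isFiniteMeasure_of_le P h
  exact le_min (hq ▸ measureReal_mono (subset_univ B))
    (ENNReal.toReal_mono (measure_ne_top _ _) (h B))

lemma measureReal_sub_apply {P ρ : Measure Ω} [IsFiniteMeasure P] (h : ρ ≤ P) {B : Set Ω}
    (hB : MeasurableSet B) : (P - ρ).real B = P.real B - ρ.real B := by
  have : IsFiniteMeasure ρ := isFiniteMeasure_of_le P h
  rw [measureReal_def, Measure.sub_apply hB h, ENNReal.toReal_sub_of_le (h B) (measure_ne_top _ _)]
  rfl

lemma eq_max_min_of_forall_Ioo {c d : ℝ} (hc : c ∈ Icc (0 : ℝ) 1)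
    (h : ∀ t ∈ Ioo (0 : ℝ) 1, t ≤ c ↔ t ≤ d) : c = max 0 (min 1 d) := by
  refine le_antisymm (le_of_forall_lt fun e he => ?_) (le_of_forall_lt fun e he => ?_)
  · rcases lt_or_ge e 0 with he0 | he0
    · exact lt_max_of_lt_left he0
    · obtain ⟨t, het, htc⟩ := exists_between he
      have ht1 := htc.trans_le hc.2
      have := (h t ⟨he0.trans_lt het, ht1⟩).1 htc.le
      exact lt_max_of_lt_right (lt_min (het.trans ht1) (het.trans_le this))
  · rcases lt_or_ge e 0 with he0 | he0
    · exact he0.trans_le hc.1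
    · rcases lt_max_iff.1 he with he | he
      · exact absurd he he0.not_gt
      · obtain ⟨t, het, htd⟩ := exists_between he
        have ht := lt_min_iff.1 htd
        exact het.trans_le ((h t ⟨he0.trans_lt het, ht.1⟩).2 ht.2.le)

lemma IsUpperTail.mul_cdf {P : Measure Ω} [IsProbabilityMeasure P] {p : ℝ} (hp : p ∈ Ioo (0 : ℝ) 1)
    {Z W : Ω → ℝ} (hZ : Measurable Z) (hW : Measurable W) (h : IsUpperTail P p Z W) (x : ℝ) :
    p * P.real {ω | W ω ≤ x} = max 0 (P.real {ω | Z ω ≤ x} - (1 - p)) := by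
  obtain ⟨hp0, hp1⟩ := hp
  have key := eq_max_min_of_forall_Ioo (c := P.real {ω | W ω ≤ x})
    (d := (P.real {ω | Z ω ≤ x} - (1 - p)) / p) ⟨measureReal_nonneg, measureReal_le_one⟩
    fun t ht => by
      rw [← leftQuantile_le_iff hW ht, h t ⟨ht.1, ht.2.le⟩, leftQuantile_le_iff hZ
        ⟨by nlinarith [ht.1], by nlinarith [ht.2]⟩, le_div_iff₀ hp0]
      constructor <;> intro <;> linarith
  have hZ1 : P.real {ω | Z ω ≤ x} ≤ 1 := measureReal_le_one
  rw [key, min_eq_right (by rw [div_le_one hp0]; linarith), mul_max_of_nonneg _ _ hp0.le, mul_zero,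
    mul_div_cancel₀ _ hp0.ne']

lemma IsLowerTail.mul_cdf {P : Measure Ω} [IsProbabilityMeasure P] {p : ℝ} (hp : p ∈ Ioo (0 : ℝ) 1)
    {Z V : Ω → ℝ} (hZ : Measurable Z) (hV : Measurable V) (h : IsLowerTail P p Z V) (x : ℝ) :
    (1 - p) * P.real {ω | V ω ≤ x} = min (1 - p) (P.real {ω | Z ω ≤ x}) := by
  obtain ⟨hp0, hp1⟩ := hp
  have hq : 0 < 1 - p := by linarith
  have key := eq_max_min_of_forall_Ioo (c := P.real {ω | V ω ≤ x})
    (d := P.real {ω | Z ω ≤ x} / (1 - p)) ⟨measureReal_nonneg, measureReal_le_one⟩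
    fun t ht => by
      rw [← leftQuantile_le_iff hV ht, h t ⟨ht.1, ht.2.le⟩, leftQuantile_le_iff hZ
        ⟨mul_pos hq ht.1, by nlinarith [ht.1, ht.2]⟩, le_div_iff₀ hq, mul_comm]
  rw [key, max_eq_right (le_min zero_le_one (div_nonneg measureReal_nonneg hq.le)),
    mul_min_of_nonneg _ _ hq.le, mul_one, mul_div_cancel₀ _ hq.ne']

lemma lintegral_cdf_le_of_joint_le {P τ τ' : Measure Ω} [IsFiniteMeasure P] [IsFiniteMeasure τ]
    [IsFiniteMeasure τ'] {X Y X' Y' W W' : Ω → ℝ} (hX : Measurable X) (hY : Measurable Y)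
    (hX' : Measurable X') (hY' : Measurable Y') {c : ℝ} (hc : 0 < c)
    (hW : ∀ x, c * P.real {ω | W ω ≤ x} ≤ τ.real {ω | X ω + Y ω ≤ x})
    (hjoint : ∀ s t, τ.real {ω | X ω ≤ s ∧ Y ω ≤ t} ≤ τ'.real {ω | X' ω ≤ s ∧ Y' ω ≤ t})
    (hW' : ∀ x, τ'.real {ω | X' ω + Y' ω ≤ x} ≤ c * P.real {ω | W' ω ≤ x}) (k : ℝ) :
    ∫⁻ x in Iic k, P {ω | W ω ≤ x} ≤ ∫⁻ x in Iic k, P {ω | W' ω ≤ x} := by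
  have hmul : ∀ (Z : Ω → ℝ) x, ENNReal.ofReal c * P {ω | Z ω ≤ x}
      = ENNReal.ofReal (c * P.real {ω | Z ω ≤ x}) := fun Z x => by
    rw [ENNReal.ofReal_mul hc.le, ofReal_measureReal]
  have hchain : ENNReal.ofReal c * ∫⁻ x in Iic k, P {ω | W ω ≤ x}
      ≤ ENNReal.ofReal c * ∫⁻ x in Iic k, P {ω | W' ω ≤ x} := by
    rw [← lintegral_const_mul' _ _ ENNReal.ofReal_ne_top,
      ← lintegral_const_mul' _ _ ENNReal.ofReal_ne_top]
    calc ∫⁻ x in Iic k, ENNReal.ofReal c * P {ω | W ω ≤ x}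
        ≤ ∫⁻ x in Iic k, τ {ω | X ω + Y ω ≤ x} := lintegral_mono fun x => by
          rw [hmul, ← ofReal_measureReal (μ := τ)]
          exact ENNReal.ofReal_le_ofReal (hW x)
      _ = ∫⁻ s, τ {ω | X ω ≤ s ∧ Y ω ≤ k - s} := lintegral_Iic_measure_add_le τ hX hY k
      _ ≤ ∫⁻ s, τ' {ω | X' ω ≤ s ∧ Y' ω ≤ k - s} := lintegral_mono fun s => by
          rw [← ofReal_measureReal (μ := τ), ← ofReal_measureReal (μ := τ')]
          exact ENNReal.ofReal_le_ofReal (hjoint s (k - s))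
      _ = ∫⁻ x in Iic k, τ' {ω | X' ω + Y' ω ≤ x} := (lintegral_Iic_measure_add_le τ' hX' hY' k).symm
      _ ≤ ∫⁻ x in Iic k, ENNReal.ofReal c * P {ω | W' ω ≤ x} := lintegral_mono fun x => by
          rw [hmul, ← ofReal_measureReal (μ := τ')]
          exact ENNReal.ofReal_le_ofReal (hW' x)
  exact (ENNReal.mul_le_mul_iff_right (by simpa using hc) ENNReal.ofReal_ne_top).1 hchain

lemma min_le_Cpm (p u v : ℝ) : min (1 - p) (min u v) ≤ Cpm p u v := by
  rw [Cpm]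
  split_ifs
  · exact min_le_right _ _
  · exact (min_le_left _ _).trans (le_max_right _ _)

lemma Cpm_sub_le (p u v : ℝ) : Cpm p u v - (1 - p) ≤ max 0 (u + v - 1 - (1 - p)) := by
  rw [Cpm]
  split_ifs with h
  · exact le_max_of_le_left (by linarith)
  · rcases max_choice (u + v - 1) (1 - p) with h | h <;> rw [h]
    · exact le_max_right _ _
    · exact le_max_of_le_left (by linarith)

/-- Tail optimality of C^±_p: for a convex distortion g and compactly
supported marginals μ, ν, a coupling (X,Y) with copula C^±_p maximizes
E^g[(X+Y)^∨_p] and minimizes E^g[(X+Y)^∧_p] among all couplings of μ and ν. -/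
theorem Cpm_tail_optimality
    (P : Measure Ω) [IsProbabilityMeasure P] (hP : AtomlessProb P)
    (g : ℝ → ℝ) (hdist : IsDistortion g) (hconv : ConvexOn ℝ (Icc 0 1) g)
    (p : ℝ) (hp : p ∈ Ioo (0:ℝ) 1)
    (μ ν : Measure ℝ) [IsProbabilityMeasure μ] [IsProbabilityMeasure ν]
    (hμc : ∃ K : Set ℝ, IsCompact K ∧ μ Kᶜ = 0)
    (hνc : ∃ K : Set ℝ, IsCompact K ∧ ν Kᶜ = 0)
    (X Y X' Y' : Ω → ℝ)
    (hXm : Measurable X) (hYm : Measurable Y) (hX'm : Measurable X') (hY'm : Measurable Y')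
    (hXμ : Measure.map X P = μ) (hYν : Measure.map Y P = ν)
    (hX'μ : Measure.map X' P = μ) (hY'ν : Measure.map Y' P = ν)
    (hcop : HasCopula P X Y (Cpm p)) :
    (∀ W W' : Ω → ℝ, IsBddRV W → IsBddRV W' →
      IsUpperTail P p (fun ω => X ω + Y ω) W →
      IsUpperTail P p (fun ω => X' ω + Y' ω) W' →
      distExp P g W' ≤ distExp P g W) ∧
    (∀ V V' : Ω → ℝ, IsBddRV V → IsBddRV V' →
      IsLowerTail P p (fun ω => X ω + Y ω) V →
      IsLowerTail P p (fun ω => X' ω + Y' ω) V' →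
      distExp P g V ≤ distExp P g V') := by
  have hq : 1 - p ∈ Ioo (0 : ℝ) 1 := ⟨by linarith [hp.2], by linarith [hp.1]⟩
  have hF : ∀ s, P.real {ω | X' ω ≤ s} = P.real {ω | X ω ≤ s} := fun s =>
    congrArg ENNReal.toReal ((IdentDistrib.mk hX'm.aemeasurable hXm.aemeasurable
      (hX'μ.trans hXμ.symm)).measure_mem_eq measurableSet_Iic)
  have hG : ∀ t, P.real {ω | Y' ω ≤ t} = P.real {ω | Y ω ≤ t} := fun t =>
    congrArg ENNReal.toReal ((IdentDistrib.mk hY'm.aemeasurable hYm.aemeasurable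
      (hY'ν.trans hYν.symm)).measure_mem_eq measurableSet_Iic)
  have hC : ∀ s t, P.real {ω | X ω ≤ s ∧ Y ω ≤ t}
      = Cpm p (P.real {ω | X ω ≤ s}) (P.real {ω | Y ω ≤ t}) := hcop
  have hSm : Measurable fun ω => X ω + Y ω := hXm.add hYm
  have hSm' : Measurable fun ω => X' ω + Y' ω := hX'm.add hY'm
  obtain ⟨ρ, hρP, hρq, hρ⟩ := exists_joint_lower_tail hXm hYm hq fun s t => by
    rw [hC]
    exact min_le_Cpm _ _ _
  obtain ⟨ρ', hρP', hρq', hρ'⟩ := exists_lower_tail (P := P) hSm' hq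
  have : IsFiniteMeasure ρ := isFiniteMeasure_of_le P hρP
  have : IsFiniteMeasure ρ' := isFiniteMeasure_of_le P hρP'
  have : IsFiniteMeasure (P - ρ) := isFiniteMeasure_of_le P Measure.sub_le
  have : IsFiniteMeasure (P - ρ') := isFiniteMeasure_of_le P Measure.sub_le
  have hB := measureReal_le_min_of_le hρP hρq
  have hB' := measureReal_le_min_of_le hρP' hρq'
  refine ⟨fun W W' hW hW' hT hT' => distExp_le_of_lintegral_cdf_le hdist hconv hW hW'
      (lintegral_cdf_le_of_joint_le (τ := P - ρ) (τ' := P - ρ') hXm hYm hX'm hY'm hp.1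
        (fun x => ?_) (fun s t => ?_) fun x => ?_),
    fun V V' hV hV' hT hT' => distExp_le_of_lintegral_cdf_le hdist hconv hV' hV
      (lintegral_cdf_le_of_joint_le (τ := ρ') (τ' := ρ) hX'm hY'm hXm hYm hq.1
        (fun x => ?_) (fun s t => ?_) fun x => ?_)⟩
  · rw [hT.mul_cdf hp hSm hW.1, measureReal_sub_apply hρP (measurableSet_le hSm measurable_const)]
    have h := le_min_iff.1 (hB {ω | X ω + Y ω ≤ x})
    exact max_le (by linarith) (by linarith)
  · have mXY : MeasurableSet {ω | X ω ≤ s ∧ Y ω ≤ t} :=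
      (measurableSet_le hXm measurable_const).inter (measurableSet_le hYm measurable_const)
    have mXY' : MeasurableSet {ω | X' ω ≤ s ∧ Y' ω ≤ t} :=
      (measurableSet_le hX'm measurable_const).inter (measurableSet_le hY'm measurable_const)
    rw [measureReal_sub_apply hρP mXY, measureReal_sub_apply hρP' mXY']
    have h := le_min_iff.1 (hB' {ω | X' ω ≤ s ∧ Y' ω ≤ t})
    have hu : P.real ({ω | X' ω ≤ s} ∪ {ω | Y' ω ≤ t}) + P.real {ω | X' ω ≤ s ∧ Y' ω ≤ t} = _ :=
      measureReal_union_add_inter (measurableSet_le hY'm measurable_const)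
    have hu1 : P.real ({ω | X' ω ≤ s} ∪ {ω | Y' ω ≤ t}) ≤ 1 := measureReal_le_one
    rw [hF, hG] at hu
    have hlow : max 0 (P.real {ω | X ω ≤ s} + P.real {ω | Y ω ≤ t} - 1 - (1 - p))
        ≤ P.real {ω | X' ω ≤ s ∧ Y' ω ≤ t} - ρ'.real {ω | X' ω ≤ s ∧ Y' ω ≤ t} :=
      max_le (by linarith) (by linarith)
    refine le_trans ?_ hlow
    have hCs := Cpm_sub_le p (P.real {ω | X ω ≤ s}) (P.real {ω | Y ω ≤ t})
    rw [← hC] at hCs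
    rcases min_le_iff.1 (hρ s t) with h | h
    · linarith
    · exact le_max_of_le_left (by linarith)
  · rw [hT'.mul_cdf hp hSm' hW'.1,
      measureReal_sub_apply hρP' (measurableSet_le hSm' measurable_const)]
    rcases min_le_iff.1 (hρ' x) with h | h
    · exact le_max_of_le_right (by linarith)
    · exact le_max_of_le_left (by linarith)
  · rw [hT'.mul_cdf hp hSm' hV'.1]
    exact hρ' x
  · refine le_trans (le_min ((hB' _).trans (min_le_left _ _)) ?_) (hρ s t)
    rw [hC]
    refine le_trans ((hB' _).trans (min_le_min_left _ (le_min ?_ ?_))) (min_le_Cpm _ _ _)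
    · rw [← hF]
      exact measureReal_mono fun ω hω => hω.1
    · rw [← hG]
      exact measureReal_mono fun ω hω => hω.2
  · rw [hT.mul_cdf hp hSm hV.1]
    exact hB _
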